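/- Let p be a prime with p ≡ 1 (mod 4) and p ≥ 13, and let a, b be positive integers with a² − p·b² = −4. Then ((a + b·√p)/2)² > 5p/(4√3). -/

import Mathlib

open Real

/-- If `p ≡ 1 (mod 4)` is a prime with `p ≥ 13` and `a, b` are positive integers with
`a² − p·b² = −4`, then `((a + b√p)/2)² > 5p/(4√3)`. -/
theorem fundamental_unit_sq_gt (p : ℕ) (hp : p.Prime) (hmod : p % 4 = 1) (hp13 : 13 ≤ p)
    (a b : ℕ) (ha : 0 < a) (hb : 0 < b) (h : (a : ℤ) ^ 2 - (p : ℤ) * (b : ℤ) ^ 2 = -4) :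
    (((a : ℝ) + (b : ℝ) * Real.sqrt p) / 2) ^ 2 > 5 * p / (4 * Real.sqrt 3) := by
  have hR : (a : ℝ) ^ 2 - (p : ℝ) * (b : ℝ) ^ 2 = -4 := by exact_mod_cast h
  have hp13' : (13 : ℝ) ≤ p := by exact_mod_cast hp13
  have hb1 : (1 : ℝ) ≤ b := by exact_mod_cast hb
  have ha0 : (0 : ℝ) ≤ a := a.cast_nonneg
  have hs0 : 0 ≤ √(p : ℝ) := Real.sqrt_nonneg _
  have hs : √(p : ℝ) ^ 2 = p := Real.sq_sqrt p.cast_nonneg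
  have hpb : (p : ℝ) ≤ p * (b : ℝ) ^ 2 :=
    le_mul_of_one_le_right p.cast_nonneg (one_le_pow₀ hb1)
  have has : (p : ℝ) - 4 ≤ a * √(p : ℝ) := by
    refine le_of_abs_le (abs_le_of_sq_le_sq ?_ (by positivity))
    rw [mul_pow, hs]
    nlinarith
  have hasb : a * √(p : ℝ) ≤ a * √(p : ℝ) * b :=
    le_mul_of_one_le_right (by positivity) hb1
  have hlower : (p : ℝ) - 3 ≤ ((a + b * √(p : ℝ)) / 2) ^ 2 := by
    have hexp : ((a + b * √(p : ℝ)) / 2) ^ 2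
        = ((a : ℝ) ^ 2 + 2 * (a * √(p : ℝ) * b) + p * (b : ℝ) ^ 2) / 4 := by
      linear_combination (b : ℝ) ^ 2 / 4 * hs
    rw [hexp]
    linarith
  have h3 : (1.7 : ℝ) < √3 := Real.lt_sqrt_of_sq_lt (by norm_num)
  refine lt_of_lt_of_le ?_ hlower
  rw [div_lt_iff₀ (by positivity)]
  nlinarith
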